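/- Let (Ω, 𝓕, P) be a probability space, X : Ω → E a measurable map into a measurable space E, and Y : Ω → {0,1} a measurable binary label. Let p̂ : E → [0,1] be measurable and calibrated, i.e. the conditional expectation of Y given the σ-algebra generated by p̂ ∘ X equals p̂ ∘ X almost surely. Let z : E → ℝ be measurable with |z(x)| ≤ 1 for all x, and let ε ≥ 0. Then E[1{p̂(X) + ε·z(X) > 1/2}·Y + 1{p̂(X) + ε·z(X) ≤ 1/2}·(1 − Y)] ≥ E[p̂(X)·1{p̂(X) > 1/2 + ε} + (1 − p̂(X))·1{p̂(X) ≤ 1/2 − ε}]. -/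

import Mathlib

open MeasureTheory ProbabilityTheory

/-- On an event that depends only on `q`, a calibrated prediction `q` of `Y` has the same
integral as `Y`. -/
lemma setIntegral_preimage_eq_of_condExp_comap_eq
    {Ω : Type*} [MeasurableSpace Ω] {μ : Measure Ω} [IsFiniteMeasure μ] {Y q : Ω → ℝ}
    (hY : Integrable Y μ) (hq : Measurable q)
    (hcal : μ[Y | MeasurableSpace.comap q Real.measurableSpace] =ᵐ[μ] q)
    {S : Set ℝ} (hS : MeasurableSet S) :
    ∫ ω in q ⁻¹' S, q ω ∂μ = ∫ ω in q ⁻¹' S, Y ω ∂μ := by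
  rw [← setIntegral_condExp hq.comap_le hY ⟨S, hS, rfl⟩]
  exact integral_congr_ae (ae_restrict_of_ae hcal.symm)

/-- A perturbation of size at most `ε` cannot flip a decision whose margin exceeds `ε`. -/
lemma margin_agreement_le {a t y ε : ℝ} (hy : y ∈ Set.Icc (0 : ℝ) 1) (ht : |t| ≤ 1)
    (hε : 0 ≤ ε) :
    (if a > 1 / 2 + ε then y else 0) + (if a ≤ 1 / 2 - ε then 1 - y else 0)
      ≤ (if a + ε * t > 1 / 2 then (1 : ℝ) else 0) * y
        + (if a + ε * t ≤ 1 / 2 then (1 : ℝ) else 0) * (1 - y) := by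
  obtain ⟨hy0, hy1⟩ := hy
  obtain ⟨ht0, ht1⟩ := abs_le.mp ht
  have h1 : ε * t ≤ ε := by nlinarith
  have h2 : -ε ≤ ε * t := by nlinarith
  split_ifs <;> linarith

/-- The chain of intermediate inequalities in the proof of Theorem 1 (argmax soft label
case) of the paper: for a calibrated `p̂` and a watermark signal `z` with `|z| ≤ 1`,
`E[1{p̂(X) + ε·z(X) > 1/2}·Y + 1{p̂(X) + ε·z(X) ≤ 1/2}·(1 − Y)]
  ≥ E[p̂(X)·1{p̂(X) > 1/2 + ε} + (1 − p̂(X))·1{p̂(X) ≤ 1/2 − ε}]`. -/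
theorem drw_argmax_soft_intermediate_bound
    {Ω : Type*} [MeasurableSpace Ω] {μ : Measure Ω} [IsProbabilityMeasure μ]
    {E : Type*} [MeasurableSpace E]
    (X : Ω → E) (hX : Measurable X)
    (Y : Ω → ℝ) (hY : Measurable Y) (hY01 : ∀ ω, Y ω = 0 ∨ Y ω = 1)
    (p : E → ℝ) (hp : Measurable p) (hp01 : ∀ x, p x ∈ Set.Icc (0 : ℝ) 1)
    (hcal : μ[Y | MeasurableSpace.comap (fun ω => p (X ω)) Real.measurableSpace]
      =ᵐ[μ] fun ω => p (X ω))
    (z : E → ℝ) (hz : Measurable z) (hz1 : ∀ x, |z x| ≤ 1)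
    (ε : ℝ) (hε : 0 ≤ ε) :
    ∫ ω, ((if p (X ω) + ε * z (X ω) > 1 / 2 then (1 : ℝ) else 0) * Y ω
        + (if p (X ω) + ε * z (X ω) ≤ 1 / 2 then (1 : ℝ) else 0) * (1 - Y ω)) ∂μ
      ≥ ∫ ω, (p (X ω) * (if p (X ω) > 1 / 2 + ε then (1 : ℝ) else 0)
          + (1 - p (X ω)) * (if p (X ω) ≤ 1 / 2 - ε then (1 : ℝ) else 0)) ∂μ := by
  have hq : Measurable fun ω => p (X ω) := hp.comp hX
  have hYmem : ∀ ω, Y ω ∈ Set.Icc (0 : ℝ) 1 := fun ω => by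
    rcases hY01 ω with h | h <;> simp [h]
  have hYi : Integrable Y μ := .of_mem_Icc 0 1 hY.aemeasurable (.of_forall hYmem)
  have hqi : Integrable (fun ω => p (X ω)) μ :=
    .of_mem_Icc 0 1 hq.aemeasurable (.of_forall fun ω => hp01 (X ω))
  have hYi' : Integrable (fun ω => 1 - Y ω) μ := (integrable_const 1).sub hYi
  have hqi' : Integrable (fun ω => 1 - p (X ω)) μ := (integrable_const 1).sub hqi
  set A : Set Ω := (fun ω => p (X ω)) ⁻¹' Set.Ioi (1 / 2 + ε)
  set B : Set Ω := (fun ω => p (X ω)) ⁻¹' Set.Iic (1 / 2 - ε)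
  have hA : MeasurableSet A := hq measurableSet_Ioi
  have hB : MeasurableSet B := hq measurableSet_Iic
  have indicator_A (f : Ω → ℝ) (ω : Ω) :
      A.indicator f ω = if p (X ω) > 1 / 2 + ε then f ω else 0 := by
    split_ifs with h
    exacts [Set.indicator_of_mem (s := A) h f, Set.indicator_of_notMem (s := A) h f]
  have indicator_B (f : Ω → ℝ) (ω : Ω) :
      B.indicator f ω = if p (X ω) ≤ 1 / 2 - ε then f ω else 0 := by
    split_ifs with h
    exacts [Set.indicator_of_mem (s := B) h f, Set.indicator_of_notMem (s := B) h f]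
  have hcalA : ∫ ω in A, p (X ω) ∂μ = ∫ ω in A, Y ω ∂μ :=
    setIntegral_preimage_eq_of_condExp_comap_eq hYi hq hcal measurableSet_Ioi
  have hcalB : ∫ ω in B, (1 - p (X ω)) ∂μ = ∫ ω in B, (1 - Y ω) ∂μ := by
    rw [integral_sub (integrable_const _) hqi.integrableOn,
      integral_sub (integrable_const _) hYi.integrableOn,
      setIntegral_preimage_eq_of_condExp_comap_eq hYi hq hcal measurableSet_Iic]
  calc ∫ ω, (p (X ω) * (if p (X ω) > 1 / 2 + ε then (1 : ℝ) else 0)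
          + (1 - p (X ω)) * (if p (X ω) ≤ 1 / 2 - ε then (1 : ℝ) else 0)) ∂μ
      = ∫ ω, (A.indicator (fun ω => p (X ω)) ω + B.indicator (fun ω => 1 - p (X ω)) ω) ∂μ := by
        simp only [indicator_A, indicator_B, mul_ite, mul_one, mul_zero]
    _ = ∫ ω, (A.indicator Y ω + B.indicator (fun ω => 1 - Y ω) ω) ∂μ := by
        rw [integral_add (hqi.indicator hA) (hqi'.indicator hB),
          integral_add (hYi.indicator hA) (hYi'.indicator hB)]
        simp only [integral_indicator hA, integral_indicator hB, hcalA, hcalB]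
    _ ≤ _ := by
        refine integral_mono ((hYi.indicator hA).add (hYi'.indicator hB)) ?_ fun ω => ?_
        · have hs : Measurable fun ω => p (X ω) + ε * z (X ω) :=
            hq.add ((hz.comp hX).const_mul ε)
          refine .of_mem_Icc 0 1 (Measurable.aemeasurable ?_) (.of_forall fun ω => ?_)
          · exact ((Measurable.ite (hs measurableSet_Ioi) measurable_const measurable_const).mul
              hY).add ((Measurable.ite (hs measurableSet_Iic) measurable_const
                measurable_const).mul (measurable_const.sub hY))
          · obtain ⟨h0, h1⟩ := hYmem ω
            constructor <;> split_ifs <;> linarith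
        · simp only [indicator_A, indicator_B]
          exact margin_agreement_le (a := p (X ω)) (hYmem ω) (hz1 (X ω)) hε
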